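/- arXiv:0704.2018 — 2 statements merged into one kernel-verified Lean document; each statement's English description precedes it below -/
import Mathlib

section
/- For every t > 0 and x ∈ ℝ, the variance function σ²(t,x) := ∫₀ᵗ ∫₀¹ g_{t−s}(x,y)² dy ds is finite and satisfies the explicit formula σ²(t,x) = Σ_{n=1}^∞ 2·sin²(nπx)·(1 − exp(−n²π²t))/(n²π²). -/
open Real MeasureTheory

/-- The Dirichlet heat kernel on `[0,1]`:
`g_t(x,y) = ∑_{n=1}^∞ 2 exp(−n²π²t/2) sin(nπx) sin(nπy)` (indexed here by `n+1`, `n : ℕ`). -/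
noncomputable def heatKernel (t x y : ℝ) : ℝ :=
  ∑' n : ℕ, 2 * Real.exp (-(((n : ℝ) + 1) ^ 2 * π ^ 2 * t) / 2) *
    Real.sin (((n : ℝ) + 1) * π * x) * Real.sin (((n : ℝ) + 1) * π * y)

/-- The variance of the solution of the stochastic heat equation:
`σ²(t,x) = ∫₀ᵗ ∫₀¹ g_{t−s}(x,y)² dy ds` (so `σ²(0,x) = 0`). -/
noncomputable def variance (t x : ℝ) : ℝ :=
  ∫ s in (0:ℝ)..t, ∫ y in (0:ℝ)..1, (heatKernel (t - s) x y) ^ 2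

theorem integral_sin_sq_mul_pi (m : ℕ) :
    ∫ y in (0:ℝ)..1, sin (((m : ℝ) + 1) * π * y) ^ 2 = 1 / 2 := by
  have hc : ((m : ℝ) + 1) * π ≠ 0 := by positivity
  rw [intervalIntegral.integral_comp_mul_left (fun z => sin z ^ 2) hc, integral_sin_sq]
  have : sin (((m : ℝ) + 1) * π) = 0 := by exact_mod_cast sin_nat_mul_pi (m + 1)
  simp [this]
  field_simp

theorem integral_cos_int_mul_pi {k : ℤ} (hk : k ≠ 0) :
    ∫ y in (0:ℝ)..1, cos ((k : ℝ) * π * y) = 0 := by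
  have hc : (k : ℝ) * π ≠ 0 := mul_ne_zero (by exact_mod_cast hk) pi_ne_zero
  rw [intervalIntegral.integral_comp_mul_left cos hc, integral_cos]
  simp [sin_int_mul_pi]

/-- Orthogonality of the Dirichlet sine modes on `[0,1]`. -/
theorem integral_sin_mul_sin (m n : ℕ) :
    ∫ y in (0:ℝ)..1, sin (((m : ℝ) + 1) * π * y) * sin (((n : ℝ) + 1) * π * y) =
      if m = n then 1 / 2 else 0 := by
  split_ifs with h
  · subst h
    simpa only [pow_two] using integral_sin_sq_mul_pi m
  · have h₁ : ((m : ℤ) - n) ≠ 0 := by omega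
    have h₂ : ((m : ℤ) + n + 2) ≠ 0 := by omega
    have e (y : ℝ) : sin (((m : ℝ) + 1) * π * y) * sin (((n : ℝ) + 1) * π * y) =
        (cos ((((m : ℤ) - n : ℤ) : ℝ) * π * y) -
          cos ((((m : ℤ) + n + 2 : ℤ) : ℝ) * π * y)) / 2 := by
      push_cast
      rw [show ((m : ℝ) - n) * π * y = (m + 1) * π * y - (n + 1) * π * y by ring,
        show ((m : ℝ) + n + 2) * π * y = (m + 1) * π * y + (n + 1) * π * y by ring,
        cos_sub, cos_add]
      ring
    simp_rw [e]
    rw [intervalIntegral.integral_div, intervalIntegral.integral_sub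
      (Continuous.intervalIntegrable (by fun_prop) _ _)
      (Continuous.intervalIntegrable (by fun_prop) _ _),
      integral_cos_int_mul_pi h₁, integral_cos_int_mul_pi h₂]
    simp

theorem norm_mul_sin_le (c z : ℝ) : ‖c * sin z‖ ≤ |c| := by
  rw [norm_mul, norm_eq_abs, norm_eq_abs]
  exact mul_le_of_le_one_right (abs_nonneg c) (abs_sin_le_one z)

/-- Termwise integration of an absolutely convergent sine series against a continuous function. -/
theorem hasSum_integral_mul_sin_series {a : ℕ → ℝ} (ha : Summable fun n => |a n|)
    {φ : ℝ → ℝ} (hφ : Continuous φ) :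
    HasSum (fun n => a n * ∫ y in (0:ℝ)..1, φ y * sin (((n : ℝ) + 1) * π * y))
      (∫ y in (0:ℝ)..1, φ y * ∑' n, a n * sin (((n : ℝ) + 1) * π * y)) := by
  simp_rw [← intervalIntegral.integral_const_mul]
  refine intervalIntegral.hasSum_integral_of_dominated_convergence
    (fun n y => |φ y| * |a n|) (fun n => ?_) (fun n => ?_) ?_ ?_ ?_
  · exact Continuous.aestronglyMeasurable (by fun_prop)
  · refine .of_forall fun y _ => ?_
    rw [mul_left_comm, norm_mul, norm_eq_abs]
    gcongr
    exact norm_mul_sin_le _ _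
  · exact .of_forall fun y _ => ha.mul_left _
  · simp_rw [tsum_mul_left]
    exact Continuous.intervalIntegrable (by fun_prop) _ _
  · refine .of_forall fun y _ => ?_
    simp_rw [mul_left_comm (a _)]
    exact (ha.of_norm_bounded fun n => norm_mul_sin_le _ _).hasSum.mul_left _

/-- Parseval's identity for an absolutely convergent sine series. -/
theorem integral_sin_series_sq {a : ℕ → ℝ} (ha : Summable fun n => |a n|) :
    ∫ y in (0:ℝ)..1, (∑' n, a n * sin (((n : ℝ) + 1) * π * y)) ^ 2 = ∑' n, a n ^ 2 / 2 := by
  have hcont : Continuous fun y : ℝ => ∑' n, a n * sin (((n : ℝ) + 1) * π * y) :=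
    continuous_tsum (fun n => by fun_prop) ha fun n y => norm_mul_sin_le _ _
  have hcoef (m : ℕ) : ∫ y in (0:ℝ)..1, (∑' n, a n * sin (((n : ℝ) + 1) * π * y)) *
      sin (((m : ℝ) + 1) * π * y) = a m / 2 := by
    simp_rw [mul_comm (tsum _)]
    rw [← (hasSum_integral_mul_sin_series ha
      (φ := fun y => sin (((m : ℝ) + 1) * π * y)) (by fun_prop)).tsum_eq]
    simp_rw [integral_sin_mul_sin]
    rw [tsum_eq_single m fun n hn => by simp [hn.symm]]
    simp [div_eq_mul_inv]
  simp_rw [pow_two]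
  rw [← (hasSum_integral_mul_sin_series ha hcont).tsum_eq]
  simp_rw [hcoef, mul_div_assoc]

theorem summable_heatKernel_coeff {u : ℝ} (hu : 0 < u) (x : ℝ) :
    Summable fun n : ℕ => |2 * exp (-(((n : ℝ) + 1) ^ 2 * π ^ 2 * u) / 2) *
      sin (((n : ℝ) + 1) * π * x)| := by
  have hc : -(π ^ 2 * u / 2) < 0 := by
    have : 0 < π ^ 2 * u / 2 := by positivity
    linarith
  refine .of_nonneg_of_le (fun n => abs_nonneg _) (fun n => ?_)
    ((summable_exp_nat_mul_iff.2 hc).mul_left 2)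
  refine (norm_mul_sin_le _ _).trans ?_
  rw [abs_of_nonneg (by positivity)]
  gcongr
  have h : (n : ℝ) ≤ ((n : ℝ) + 1) ^ 2 := by nlinarith [n.cast_nonneg (α := ℝ)]
  nlinarith [mul_le_mul_of_nonneg_right h (by positivity : 0 ≤ π ^ 2 * u / 2)]

theorem integral_heatKernel_sq {u : ℝ} (hu : 0 < u) (x : ℝ) :
    ∫ y in (0:ℝ)..1, heatKernel u x y ^ 2 =
      ∑' n : ℕ, 2 * sin (((n : ℝ) + 1) * π * x) ^ 2 *
        exp (-(((n : ℝ) + 1) ^ 2 * π ^ 2 * u)) := by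
  simp only [heatKernel]
  rw [integral_sin_series_sq (summable_heatKernel_coeff hu x)]
  refine tsum_congr fun n => ?_
  rw [mul_pow, mul_pow, ← exp_nat_mul]
  push_cast
  rw [mul_div_cancel₀ _ (two_ne_zero' ℝ)]
  ring

/-- A series of nonnegative integrable functions with summable integrals is integrable. -/
theorem integrable_tsum_of_nonneg {α ι : Type*} [MeasurableSpace α] {μ : Measure α} [Countable ι]
    {F : ι → α → ℝ} (hF : ∀ i, Integrable (F i) μ) (h0 : ∀ i a, 0 ≤ F i a)
    (hs : Summable fun i => ∫ a, F i a ∂μ) : Integrable (fun a => ∑' i, F i a) μ := by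
  have e (a : α) : ∑' i, F i a = (∑' i, ENNReal.ofReal (F i a)).toReal := by
    rw [ENNReal.tsum_toReal_eq fun i => ENNReal.ofReal_ne_top]
    simp [ENNReal.toReal_ofReal, h0]
  simp_rw [e]
  have hm (i : ι) : AEMeasurable (fun a => ENNReal.ofReal (F i a)) μ :=
    (hF i).aemeasurable.ennreal_ofReal
  refine integrable_toReal_of_lintegral_ne_top (AEMeasurable.tsum hm) ?_
  rw [lintegral_tsum hm]
  simp_rw [← ofReal_integral_eq_lintegral_ofReal (hF _) (.of_forall (h0 _))]
  rw [← ENNReal.ofReal_tsum_of_nonneg (fun i => integral_nonneg (h0 i)) hs]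
  exact ENNReal.ofReal_ne_top

theorem integral_exp_neg_mul_sub {c : ℝ} (hc : c ≠ 0) (t : ℝ) :
    ∫ s in (0:ℝ)..t, exp (-(c * (t - s))) = (1 - exp (-(c * t))) / c := by
  rw [intervalIntegral.integral_comp_sub_left (fun u => exp (-(c * u)))]
  simp_rw [← neg_mul]
  rw [intervalIntegral.integral_comp_mul_left exp (neg_ne_zero.2 hc), integral_exp]
  simp
  field_simp
  ring

/-- For every `t > 0` and `x ∈ ℝ`, the variance `σ²(t,x)` is finite (the inner integral is
integrable in `s` over `(0,t]`) and satisfies the explicit formula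
`σ²(t,x) = ∑_{n=1}^∞ 2 sin²(nπx) (1 − exp(−n²π²t))/(n²π²)`. -/
theorem variance_formula (t : ℝ) (ht : 0 < t) (x : ℝ) :
    IntegrableOn (fun s => ∫ y in (0:ℝ)..1, (heatKernel (t - s) x y) ^ 2) (Set.Ioc 0 t) ∧
    variance t x =
      ∑' n : ℕ, 2 * Real.sin (((n : ℝ) + 1) * π * x) ^ 2 *
        (1 - Real.exp (-(((n : ℝ) + 1) ^ 2 * π ^ 2 * t))) / (((n : ℝ) + 1) ^ 2 * π ^ 2) := by
  set F : ℕ → ℝ → ℝ := fun n s => 2 * sin (((n : ℝ) + 1) * π * x) ^ 2 *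
    exp (-(((n : ℝ) + 1) ^ 2 * π ^ 2 * (t - s)))
  have hF0 (n : ℕ) (s : ℝ) : 0 ≤ F n s := by positivity
  have hFint (n : ℕ) : IntegrableOn (F n) (Set.Ioc 0 t) :=
    (Continuous.integrableOn_Icc (by fun_prop)).mono_set Set.Ioc_subset_Icc_self
  have hFval (n : ℕ) : ∫ s in Set.Ioc 0 t, F n s = 2 * sin (((n : ℝ) + 1) * π * x) ^ 2 *
      (1 - exp (-(((n : ℝ) + 1) ^ 2 * π ^ 2 * t))) / (((n : ℝ) + 1) ^ 2 * π ^ 2) := by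
    rw [← intervalIntegral.integral_of_le ht.le, intervalIntegral.integral_const_mul,
      integral_exp_neg_mul_sub (by positivity), mul_div_assoc]
  have hsum : Summable fun n => ∫ s in Set.Ioc 0 t, F n s := by
    have h := (summable_nat_add_iff 1).2 (Real.summable_one_div_nat_pow.2 one_lt_two)
    refine .of_nonneg_of_le (fun n => integral_nonneg (hF0 n)) (fun n => ?_)
      (h.mul_left (2 / π ^ 2))
    rw [hFval, show 2 / π ^ 2 * (1 / ((n + 1 : ℕ) : ℝ) ^ 2) =
      2 * 1 * 1 / (((n : ℝ) + 1) ^ 2 * π ^ 2) by push_cast; field_simp]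
    have h₁ : exp (-(((n : ℝ) + 1) ^ 2 * π ^ 2 * t)) ≤ 1 :=
      exp_le_one_iff.2 (neg_nonpos.2 (by positivity))
    gcongr
    · exact sin_sq_le_one _
    · linarith [exp_pos (-(((n : ℝ) + 1) ^ 2 * π ^ 2 * t))]
  have hae : (fun s => ∫ y in (0:ℝ)..1, heatKernel (t - s) x y ^ 2)
      =ᵐ[volume.restrict (Set.Ioc 0 t)] fun s => ∑' n, F n s := by
    rw [← restrict_Ioo_eq_restrict_Ioc]
    filter_upwards [ae_restrict_mem measurableSet_Ioo] with s hs
    exact integral_heatKernel_sq (sub_pos.2 hs.2) x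
  refine ⟨(integrable_tsum_of_nonneg hFint hF0 hsum).congr hae.symm, ?_⟩
  rw [variance, intervalIntegral.integral_of_le ht.le, integral_congr_ae hae,
    ← integral_tsum_of_summable_integral_norm hFint
      (by simpa only [norm_of_nonneg (hF0 _ _)] using hsum)]
  exact tsum_congr hFval
end

section
/- Duhamel's formula: let T > 0 and let f : ℝ × ℝ → ℝ be a smooth function with compact support contained in (0,T) × (0,1). Define m(v,x) := ∫₀ᵛ ∫₀¹ g_{v−s}(x,y)·f(s,y) dy ds for v ∈ (0,T] and m(0,x) := 0. Then for every v ∈ (0,T) and x ∈ (0,1), m is differentiable in v and twice differentiable in x, and ∂/∂v m(v,x) = f(v,x) + (1/2)·∂²/∂x² m(v,x); moreover m(v,0) = m(v,1) = 0 for all v. -/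
open Real MeasureTheory

/-- `m(v,x) := ∫₀ᵛ ∫₀¹ g_{v−s}(x,y) f(s,y) dy ds` (so `m(0,x) = 0`). -/
noncomputable def duhamel (f : ℝ × ℝ → ℝ) (v x : ℝ) : ℝ :=
  ∫ s in (0:ℝ)..v, ∫ y in (0:ℝ)..1, heatKernel (v - s) x y * f (s, y)

/-- The `r`-th Fourier sine coefficient `2 ∫₀¹ sin(rπy) h(y) dy` of `h` on `[0,1]`. -/
noncomputable def sineCoeff (h : ℝ → ℝ) (r : ℝ) : ℝ :=
  2 * ∫ y in (0:ℝ)..1, Real.sin (r * π * y) * h y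

/-- The partial derivative in the second variable. -/
noncomputable def derivSnd (f : ℝ × ℝ → ℝ) (p : ℝ × ℝ) : ℝ := fderiv ℝ f p (0, 1)

lemma sin_natCast_add_one_mul_pi (n : ℕ) : Real.sin (((n : ℝ) + 1) * π) = 0 := by
  exact_mod_cast Real.sin_nat_mul_pi (n + 1)

lemma sineCoeff_neg (h : ℝ → ℝ) (r : ℝ) : sineCoeff h (-r) = -sineCoeff h r := by
  simp [sineCoeff, neg_mul, Real.sin_neg]

/-- The Fourier coefficients on `[-1,1]` of the odd extension of `h` are multiples of its sine
coefficients on `[0,1]`. -/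
lemma fourierCoeffOn_odd_extension {h : ℝ → ℝ} (hc : Continuous h) (h0 : ∀ y ≤ 0, h y = 0)
    (k : ℤ) (hab : (-1 : ℝ) < -1 + 2) :
    fourierCoeffOn hab (fun y => ((h y - h (-y) : ℝ) : ℂ)) k
      = -(Complex.I / 2) * (sineCoeff h k : ℂ) := by
  have key : ∀ y : ℝ, (fourier (-k) (y : AddCircle ((-1 : ℝ) + 2 - -1)) : ℂ)
      = Complex.exp (-(Complex.I * ((k * π * y : ℝ) : ℂ))) := by
    intro y
    rw [fourier_coe_apply]
    congr 1
    push_cast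
    ring
  rw [fourierCoeffOn_eq_integral]
  simp only [key, smul_eq_mul]
  have e1 : (-1 : ℝ) + 2 = 1 := by norm_num
  rw [e1]
  have hi : ∀ a b : ℝ, IntervalIntegrable (fun y : ℝ =>
      Complex.exp (-(Complex.I * ((k * π * y : ℝ) : ℂ))) * ((h y - h (-y) : ℝ) : ℂ))
      volume a b := fun a b => Continuous.intervalIntegrable (by fun_prop) _ _
  rw [← intervalIntegral.integral_add_adjacent_intervals (hi (-1) 0) (hi 0 1)]
  have e2 := intervalIntegral.integral_comp_neg (a := 0) (b := 1) (fun y : ℝ =>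
      Complex.exp (-(Complex.I * ((k * π * y : ℝ) : ℂ))) * ((h y - h (-y) : ℝ) : ℂ))
  rw [neg_zero] at e2
  rw [← e2, ← intervalIntegral.integral_add
    (Continuous.intervalIntegrable (by fun_prop) _ _) (hi 0 1)]
  have e3 : ∀ y ∈ Set.uIcc (0 : ℝ) 1,
      Complex.exp (-(Complex.I * ((k * π * -y : ℝ) : ℂ))) * ((h (-y) - h (- -y) : ℝ) : ℂ)
      + Complex.exp (-(Complex.I * ((k * π * y : ℝ) : ℂ))) * ((h y - h (-y) : ℝ) : ℂ)
      = -(2 * Complex.I) * ((Real.sin (k * π * y) * h y : ℝ) : ℂ) := by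
    intro y hy
    rw [Set.uIcc_of_le zero_le_one] at hy
    rw [h0 (-y) (by linarith [hy.1]), neg_neg]
    have a1 : -(Complex.I * ((k * π * -y : ℝ) : ℂ)) = ((k * π * y : ℝ) : ℂ) * Complex.I := by
      push_cast; ring
    have a2 : -(Complex.I * ((k * π * y : ℝ) : ℂ)) = ((-(k * π * y) : ℝ) : ℂ) * Complex.I := by
      push_cast; ring
    rw [a1, a2, Complex.exp_mul_I, Complex.exp_mul_I]
    push_cast
    rw [Complex.cos_neg, Complex.sin_neg]
    ring
  rw [intervalIntegral.integral_congr e3, intervalIntegral.integral_const_mul,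
    intervalIntegral.integral_ofReal, sineCoeff]
  rw [Complex.real_smul]
  push_cast
  ring

/-- Pointwise convergence of the Fourier sine series, when its coefficients are summable. -/
lemma hasSum_sineCoeff_mul_sin {h : ℝ → ℝ} (hc : Continuous h) (h0 : ∀ y ≤ 0, h y = 0)
    (h1 : ∀ y, 1 ≤ y → h y = 0) (hs : Summable fun n : ℕ => sineCoeff h ((n : ℝ) + 1))
    {x : ℝ} (hx : x ∈ Set.Ioo (0 : ℝ) 1) :
    HasSum (fun n : ℕ => sineCoeff h ((n : ℝ) + 1) * Real.sin (((n : ℝ) + 1) * π * x)) (h x) := by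
  have : Fact ((0 : ℝ) < 2) := ⟨two_pos⟩
  set F : ℝ → ℂ := fun y => ((h y - h (-y) : ℝ) : ℂ) with hF
  have hFc : Continuous F := by fun_prop
  have hcont : Continuous (AddCircle.liftIco (2 : ℝ) (-1) F) := by
    apply AddCircle.liftIco_continuous _ hFc.continuousOn
    have e1 : (-1 : ℝ) + 2 = 1 := by norm_num
    simp only [hF]
    rw [e1, neg_neg, h0 (-1) (by norm_num), h1 1 le_rfl]
  have hcoef : ∀ k : ℤ, fourierCoeff (AddCircle.liftIco (2 : ℝ) (-1) F) k
      = -(Complex.I / 2) * (sineCoeff h k : ℂ) := by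
    intro k
    rw [fourierCoeff_liftIco_eq]
    exact fourierCoeffOn_odd_extension hc h0 k _
  have hs' : Summable fun n : ℕ => (sineCoeff h (n : ℝ) : ℂ) := by
    rw [← summable_nat_add_iff 1]
    exact_mod_cast hs
  have hsum : Summable (fourierCoeff (⇑(⟨_, hcont⟩ : C(AddCircle (2 : ℝ), ℂ)))) := by
    apply Summable.of_nat_of_neg
    · simp only [ContinuousMap.coe_mk, hcoef]
      exact_mod_cast hs'.mul_left _
    · simp only [ContinuousMap.coe_mk, hcoef, Int.cast_neg, sineCoeff_neg, Int.cast_natCast]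
      push_cast
      exact (hs'.neg).mul_left _
  have main := (has_pointwise_sum_fourier_series_of_summable hsum (x : AddCircle (2 : ℝ))).nat_add_neg
  rw [← hasSum_nat_add_iff' 1] at main
  simp only [ContinuousMap.coe_mk, hcoef] at main
  rw [AddCircle.liftIco_coe_apply (by constructor <;> linarith [hx.1, hx.2])] at main
  have hval : F x + (-(Complex.I / 2) * (sineCoeff h ((0 : ℤ) : ℝ) : ℂ)) •
        fourier 0 (x : AddCircle (2 : ℝ))
      - ∑ i ∈ Finset.range 1, ((-(Complex.I / 2) * (sineCoeff h (((i : ℕ) : ℤ) : ℝ) : ℂ)) •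
        fourier (i : ℤ) (x : AddCircle (2 : ℝ)) + (-(Complex.I / 2) *
        (sineCoeff h ((-(i : ℤ) : ℤ) : ℝ) : ℂ)) • fourier (-(i : ℤ)) (x : AddCircle (2 : ℝ)))
      = ((h x : ℝ) : ℂ) := by
    simp [hF, h0 (-x) (by linarith [hx.1]), sineCoeff]
  rw [hval] at main
  rw [← Complex.hasSum_ofReal]
  refine main.congr_fun fun n => ?_
  simp only [fourier_coe_apply, Int.cast_neg, sineCoeff_neg, smul_eq_mul]
  have a1 : 2 * (π : ℂ) * Complex.I * (((n + 1 : ℕ) : ℤ) : ℂ) * x / ((2 : ℝ) : ℂ)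
    = ((((n : ℝ) + 1) * π * x : ℝ) : ℂ) * Complex.I := by push_cast; ring
  have a2 : 2 * (π : ℂ) * Complex.I * -(((n + 1 : ℕ) : ℤ) : ℂ) * x / ((2 : ℝ) : ℂ)
    = ((-(((n : ℝ) + 1) * π * x) : ℝ) : ℂ) * Complex.I := by push_cast; ring
  rw [a1, a2, Complex.exp_mul_I, Complex.exp_mul_I]
  push_cast
  rw [Complex.cos_neg, Complex.sin_neg]
  linear_combination ((sineCoeff h ((n : ℝ) + 1) : ℂ)
    * Complex.sin (((n : ℂ) + 1) * π * x)) * Complex.I_sq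

lemma contDiff_derivSnd {f : ℝ × ℝ → ℝ} (hf : ContDiff ℝ (⊤ : ℕ∞) f) :
    ContDiff ℝ (⊤ : ℕ∞) (derivSnd f) :=
  (hf.fderiv_right (m := (⊤ : ℕ∞)) (by simp)).clm_apply contDiff_const

lemma hasDerivAt_derivSnd {f : ℝ × ℝ → ℝ} (hf : ContDiff ℝ (⊤ : ℕ∞) f) (s y : ℝ) :
    HasDerivAt (fun y => f (s, y)) (derivSnd f (s, y)) y := by
  have h1 : HasFDerivAt f (fderiv ℝ f (s, y)) (s, y) :=
    (hf.differentiable (by simp) _).hasFDerivAt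
  have h2 : HasDerivAt (fun y : ℝ => (s, y)) ((0 : ℝ), (1 : ℝ)) y :=
    (hasDerivAt_const y s).prodMk (hasDerivAt_id y)
  exact h1.comp_hasDerivAt y h2

/-- Integrating by parts twice: passing to the second derivative multiplies the sine coefficient
by `-(nπ)²`. -/
lemma sineCoeff_derivSnd_derivSnd {f : ℝ × ℝ → ℝ} (hf : ContDiff ℝ (⊤ : ℕ∞) f)
    (h0 : ∀ s, f (s, 0) = 0) (h1 : ∀ s, f (s, 1) = 0) (n : ℕ) (s : ℝ) :
    sineCoeff (fun y => derivSnd (derivSnd f) (s, y)) ((n : ℝ) + 1)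
      = -((((n : ℝ) + 1) * π) ^ 2) * sineCoeff (fun y => f (s, y)) ((n : ℝ) + 1) := by
  have hf1 := contDiff_derivSnd hf
  have hc0 := hf.continuous
  have hc1 := hf1.continuous
  have hc2 := (contDiff_derivSnd hf1).continuous
  set c : ℝ := ((n : ℝ) + 1) * π with hc
  have hlin : ∀ y : ℝ, HasDerivAt (fun y => c * y) c y := fun y => by
    simpa using (hasDerivAt_id y).const_mul c
  have i1 := intervalIntegral.integral_mul_deriv_eq_deriv_mul (a := 0) (b := 1)
    (fun y _ => (hlin y).sin) (fun y _ => hasDerivAt_derivSnd hf1 s y)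
    (Continuous.intervalIntegrable (by fun_prop) _ _)
    (Continuous.intervalIntegrable (by fun_prop) _ _)
  have i2 := intervalIntegral.integral_mul_deriv_eq_deriv_mul (a := 0) (b := 1)
    (fun y _ => ((hlin y).cos).mul_const c) (fun y _ => hasDerivAt_derivSnd hf s y)
    (Continuous.intervalIntegrable (by fun_prop) _ _)
    (Continuous.intervalIntegrable (by fun_prop) _ _)
  have hsin : Real.sin c = 0 := sin_natCast_add_one_mul_pi n
  simp only [mul_one, mul_zero, hsin, Real.sin_zero, zero_mul, sub_zero, zero_sub, h0, h1] at i1 i2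
  have e : ∀ y, -Real.sin (c * y) * c * c * f (s, y) = -(c ^ 2) * (Real.sin (c * y) * f (s, y)) :=
    fun y => by ring
  simp only [e, intervalIntegral.integral_const_mul] at i2
  rw [sineCoeff, sineCoeff, i1, i2]
  ring

lemma abs_sineCoeff_le {h : ℝ → ℝ} {C : ℝ} (hC : ∀ y, |h y| ≤ C) (r : ℝ) :
    |sineCoeff h r| ≤ 2 * C := by
  have := intervalIntegral.norm_integral_le_of_norm_le_const (a := 0) (b := 1) (C := C)
    (f := fun y => Real.sin (r * π * y) * h y) (fun y _ => by
      rw [norm_mul, Real.norm_eq_abs, Real.norm_eq_abs]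
      calc _ ≤ 1 * |h y| := by gcongr; exact Real.abs_sin_le_one _
        _ ≤ C := by simpa using hC y)
  rw [sineCoeff, abs_mul, abs_two]
  simp at this
  linarith

lemma hasCompactSupport_derivSnd {f : ℝ × ℝ → ℝ} (hf : HasCompactSupport f) :
    HasCompactSupport (derivSnd f) := hf.fderiv_apply ℝ _

lemma tsupport_derivSnd_subset (f : ℝ × ℝ → ℝ) : tsupport (derivSnd f) ⊆ tsupport f :=
  tsupport_fderiv_apply_subset ℝ _

/-- The sine coefficients in the second variable of a smooth function supported in a strip decay
like `(nπ)⁻⁴`, uniformly in the first variable. -/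
lemma exists_abs_sineCoeff_le {f : ℝ × ℝ → ℝ} (hf : ContDiff ℝ (⊤ : ℕ∞) f)
    (hsupp : HasCompactSupport f) (hsub : tsupport f ⊆ {p | p.2 ∈ Set.Ioo (0 : ℝ) 1}) :
    ∃ C, ∀ (n : ℕ) (s : ℝ),
      |sineCoeff (fun y => f (s, y)) ((n : ℝ) + 1)| ≤ C / (((n : ℝ) + 1) * π) ^ 4 := by
  have hvan : ∀ g : ℝ × ℝ → ℝ, tsupport g ⊆ tsupport f →
      (∀ s, g (s, 0) = 0) ∧ ∀ s, g (s, 1) = 0 := by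
    intro g hg
    constructor <;> intro s <;> apply image_eq_zero_of_notMem_tsupport <;> intro hmem <;>
      simpa using hsub (hg hmem)
  have hsub2 : tsupport (derivSnd (derivSnd f)) ⊆ tsupport f :=
    (tsupport_derivSnd_subset _).trans (tsupport_derivSnd_subset _)
  have hf2 := contDiff_derivSnd (contDiff_derivSnd hf)
  have hf4 := contDiff_derivSnd (contDiff_derivSnd hf2)
  have hs4 := hasCompactSupport_derivSnd (hasCompactSupport_derivSnd
    (hasCompactSupport_derivSnd (hasCompactSupport_derivSnd hsupp)))
  obtain ⟨C, hC⟩ := hs4.exists_bound_of_continuous hf4.continuous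
  refine ⟨2 * C, fun n s => ?_⟩
  have hb := abs_sineCoeff_le (fun y => hC (s, y)) ((n : ℝ) + 1)
  rw [sineCoeff_derivSnd_derivSnd hf2 (hvan _ hsub2).1 (hvan _ hsub2).2,
    sineCoeff_derivSnd_derivSnd hf (hvan _ subset_rfl).1 (hvan _ subset_rfl).2] at hb
  have hpos : 0 < (((n : ℝ) + 1) * π) ^ 4 := by positivity
  rw [le_div_iff₀ hpos]
  calc _ = |-((((n : ℝ) + 1) * π) ^ 2) * (-((((n : ℝ) + 1) * π) ^ 2) *
        sineCoeff (fun y => f (s, y)) ((n : ℝ) + 1))| := by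
        rw [← mul_assoc, abs_mul, mul_comm]
        congr 1
        rw [abs_of_nonneg (by nlinarith [sq_nonneg ((((n : ℝ) + 1) * π) ^ 2)])]
        ring
    _ ≤ _ := hb

lemma continuous_sineCoeff {f : ℝ × ℝ → ℝ} (hf : Continuous f) (r : ℝ) :
    Continuous fun s => sineCoeff (fun y => f (s, y)) r := by
  unfold sineCoeff
  refine continuous_const.mul
    (intervalIntegral.continuous_parametric_intervalIntegral_of_continuous' ?_ 0 1)
  fun_prop

/-- The `n`-th eigenvalue of `-½ d²/dx²` on `[0,1]` with Dirichlet boundary conditions. -/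
noncomputable def dirichletEigenvalue (n : ℕ) : ℝ := (((n : ℝ) + 1) * π) ^ 2 / 2

lemma dirichletEigenvalue_pos (n : ℕ) : 0 < dirichletEigenvalue n := by
  unfold dirichletEigenvalue; positivity

/-- The `n`-th sine coefficient of `duhamel f v`. -/
noncomputable def duhamelCoeff (f : ℝ × ℝ → ℝ) (n : ℕ) (v : ℝ) : ℝ :=
  ∫ s in (0:ℝ)..v, Real.exp (-(dirichletEigenvalue n * (v - s))) *
    sineCoeff (fun y => f (s, y)) ((n : ℝ) + 1)

lemma hasDerivAt_duhamelCoeff {f : ℝ × ℝ → ℝ} (hf : Continuous f) (n : ℕ) (v : ℝ) :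
    HasDerivAt (duhamelCoeff f n) (sineCoeff (fun y => f (v, y)) ((n : ℝ) + 1)
      - dirichletEigenvalue n * duhamelCoeff f n v) v := by
  set l := dirichletEigenvalue n
  have hc := continuous_sineCoeff hf ((n : ℝ) + 1)
  have e : ∀ w, duhamelCoeff f n w = Real.exp (-(l * w)) *
      ∫ s in (0:ℝ)..w, Real.exp (l * s) * sineCoeff (fun y => f (s, y)) ((n : ℝ) + 1) := by
    intro w
    rw [duhamelCoeff, ← intervalIntegral.integral_const_mul]
    congr 1
    funext s
    rw [← mul_assoc, ← Real.exp_add]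
    congr 2
    ring
  have hg : Continuous fun s => Real.exp (l * s) * sineCoeff (fun y => f (s, y)) ((n : ℝ) + 1) := by
    fun_prop
  have h1 : HasDerivAt (fun w => Real.exp (-(l * w))) (Real.exp (-(l * v)) * -l) v := by
    simpa using (((hasDerivAt_id v).const_mul l).neg).exp
  have h2 := h1.mul (hg.integral_hasStrictDerivAt 0 v).hasDerivAt
  rw [show duhamelCoeff f n = _ from funext e]
  refine h2.congr_deriv ?_
  have h3 : Real.exp (-(l * v)) * Real.exp (l * v) = 1 := by rw [← Real.exp_add]; simp
  linear_combination (sineCoeff (fun y => f (v, y)) ((n : ℝ) + 1)) * h3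

lemma abs_duhamelCoeff_le {f : ℝ × ℝ → ℝ} {n : ℕ} {B : ℝ}
    (hB : ∀ s, |sineCoeff (fun y => f (s, y)) ((n : ℝ) + 1)| ≤ B) {v : ℝ} (hv : 0 ≤ v) :
    |duhamelCoeff f n v| ≤ B * v := by
  have := intervalIntegral.norm_integral_le_of_norm_le_const (a := 0) (b := v) (C := B)
    (f := fun s => Real.exp (-(dirichletEigenvalue n * (v - s))) *
      sineCoeff (fun y => f (s, y)) ((n : ℝ) + 1)) (fun s hs => by
      rw [Set.uIoc_of_le hv] at hs
      rw [norm_mul, Real.norm_eq_abs, Real.norm_eq_abs, Real.abs_exp]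
      have hexp : Real.exp (-(dirichletEigenvalue n * (v - s))) ≤ 1 := by
        rw [Real.exp_le_one_iff]
        have := mul_nonneg (dirichletEigenvalue_pos n).le (sub_nonneg.2 hs.2)
        linarith
      calc _ ≤ 1 * |sineCoeff (fun y => f (s, y)) ((n : ℝ) + 1)| := by gcongr
        _ ≤ B := by simpa using hB s)
  simpa [duhamelCoeff, abs_of_nonneg hv] using this

lemma summable_exp_neg_dirichletEigenvalue_mul {t : ℝ} (ht : 0 < t) :
    Summable fun n : ℕ => Real.exp (-(dirichletEigenvalue n * t)) := by
  have h : Summable fun n : ℕ => Real.exp ((n : ℝ) * (-(π ^ 2 / 2 * t))) :=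
    Real.summable_exp_nat_mul_iff.2 (by have := Real.pi_pos; simp only [neg_lt_zero]; positivity)
  refine Summable.of_nonneg_of_le (fun n => (Real.exp_pos _).le) (fun n => ?_) h
  apply Real.exp_le_exp.2
  have hn : (n : ℝ) ≤ ((n : ℝ) + 1) ^ 2 := by nlinarith [Nat.cast_nonneg (α := ℝ) n]
  have := mul_le_mul_of_nonneg_right hn (show 0 ≤ π ^ 2 / 2 * t by positivity)
  unfold dirichletEigenvalue
  linarith

/-- Fourier expansion of the action of the heat kernel on a bounded continuous function. -/
lemma hasSum_integral_heatKernel_mul {h : ℝ → ℝ} (hc : Continuous h) {C : ℝ}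
    (hC : ∀ y, |h y| ≤ C) {t : ℝ} (ht : 0 < t) (x : ℝ) :
    HasSum (fun n : ℕ => Real.exp (-(dirichletEigenvalue n * t)) *
      sineCoeff h ((n : ℝ) + 1) * Real.sin (((n : ℝ) + 1) * π * x))
      (∫ y in (0:ℝ)..1, heatKernel t x y * h y) := by
  have hE := summable_exp_neg_dirichletEigenvalue_mul ht
  have hexp : ∀ n : ℕ, -(((n : ℝ) + 1) ^ 2 * π ^ 2 * t) / 2 = -(dirichletEigenvalue n * t) :=
    fun n => by unfold dirichletEigenvalue; ring
  have hb : ∀ (n : ℕ) (y : ℝ), |2 * Real.exp (-(dirichletEigenvalue n * t)) *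
      Real.sin (((n : ℝ) + 1) * π * x) * Real.sin (((n : ℝ) + 1) * π * y)|
      ≤ 2 * Real.exp (-(dirichletEigenvalue n * t)) := by
    intro n y
    rw [abs_mul, abs_mul, abs_of_pos (by positivity : 0 < 2 * Real.exp _)]
    calc _ ≤ 2 * Real.exp (-(dirichletEigenvalue n * t)) * 1 * 1 := by
          gcongr <;> exact Real.abs_sin_le_one _
      _ = _ := by ring
  have hbs : ∀ y : ℝ, Summable fun n : ℕ => 2 * Real.exp (-(dirichletEigenvalue n * t)) *
      Real.sin (((n : ℝ) + 1) * π * x) * Real.sin (((n : ℝ) + 1) * π * y) :=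
    fun y => Summable.of_norm_bounded (hE.mul_left 2) (fun n => hb n y)
  have main := intervalIntegral.hasSum_integral_of_dominated_convergence (μ := volume)
    (a := 0) (b := 1) (f := fun y => heatKernel t x y * h y)
    (F := fun (n : ℕ) y => 2 * Real.exp (-(dirichletEigenvalue n * t)) *
      Real.sin (((n : ℝ) + 1) * π * x) * Real.sin (((n : ℝ) + 1) * π * y) * h y)
    (fun n _ => 2 * Real.exp (-(dirichletEigenvalue n * t)) * C)
    (fun n => (Continuous.aestronglyMeasurable (by fun_prop)))
    (fun n => .of_forall fun y _ => by
      rw [norm_mul]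
      exact mul_le_mul (hb n y) (hC y) (norm_nonneg _) (by positivity))
    (.of_forall fun y _ => (hE.mul_left 2).mul_right C)
    intervalIntegrable_const
    (.of_forall fun y _ => by
      unfold heatKernel
      simp only [hexp]
      exact (hbs y).hasSum.mul_right (h y))
  refine main.congr_fun fun n => ?_
  have e : ∀ y, 2 * Real.exp (-(dirichletEigenvalue n * t)) *
      Real.sin (((n : ℝ) + 1) * π * x) * Real.sin (((n : ℝ) + 1) * π * y) * h y
      = 2 * Real.exp (-(dirichletEigenvalue n * t)) * Real.sin (((n : ℝ) + 1) * π * x) *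
        (Real.sin (((n : ℝ) + 1) * π * y) * h y) := fun y => by ring
  simp only [e, intervalIntegral.integral_const_mul, sineCoeff]
  ring

/-- Fourier sine expansion of `duhamel f v`. -/
lemma duhamel_eq_tsum {f : ℝ × ℝ → ℝ} (hf : Continuous f) (hsupp : HasCompactSupport f)
    {B : ℕ → ℝ} (hBs : Summable B)
    (hB : ∀ (n : ℕ) s, |sineCoeff (fun y => f (s, y)) ((n : ℝ) + 1)| ≤ B n) {v : ℝ} (hv : 0 ≤ v)
    (x : ℝ) :
    duhamel f v x = ∑' n : ℕ, duhamelCoeff f n v * Real.sin (((n : ℝ) + 1) * π * x) := by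
  obtain ⟨C, hC⟩ := hsupp.exists_bound_of_continuous hf
  have main := intervalIntegral.hasSum_integral_of_dominated_convergence (μ := volume)
    (a := 0) (b := v)
    (f := fun s => ∫ y in (0:ℝ)..1, heatKernel (v - s) x y * f (s, y))
    (F := fun (n : ℕ) s => Real.exp (-(dirichletEigenvalue n * (v - s))) *
      sineCoeff (fun y => f (s, y)) ((n : ℝ) + 1) * Real.sin (((n : ℝ) + 1) * π * x))
    (fun n _ => B n)
    (fun n => by
      have := continuous_sineCoeff hf ((n : ℝ) + 1)
      exact Continuous.aestronglyMeasurable (by fun_prop))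
    (fun n => .of_forall fun s hs => by
      rw [Set.uIoc_of_le hv] at hs
      rw [norm_mul, norm_mul, Real.norm_eq_abs, Real.norm_eq_abs, Real.norm_eq_abs, Real.abs_exp]
      have hexp : Real.exp (-(dirichletEigenvalue n * (v - s))) ≤ 1 := by
        rw [Real.exp_le_one_iff]
        have := mul_nonneg (dirichletEigenvalue_pos n).le (sub_nonneg.2 hs.2)
        linarith
      calc _ ≤ 1 * |sineCoeff (fun y => f (s, y)) ((n : ℝ) + 1)| * 1 := by
            gcongr
            exact Real.abs_sin_le_one _
        _ ≤ B n := by simpa using hB n s)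
    (.of_forall fun s _ => hBs)
    intervalIntegrable_const
    (by
      filter_upwards [Measure.ae_ne volume v] with s hsv hs
      rw [Set.uIoc_of_le hv] at hs
      exact hasSum_integral_heatKernel_mul (by fun_prop) (fun y => hC (s, y))
        (sub_pos.2 (lt_of_le_of_ne hs.2 hsv)) x)
  rw [duhamel, ← main.tsum_eq]
  congr 1
  funext n
  rw [intervalIntegral.integral_mul_const, duhamelCoeff]

/-- A sine series with coefficients `O(n⁻⁴)` may be differentiated twice term by term. -/
lemma hasDerivAt_tsum_mul_sin {c : ℕ → ℝ} {K : ℝ}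
    (hc : ∀ n : ℕ, |c n| ≤ K / (((n : ℝ) + 1) * π) ^ 4)
    (hS : Summable fun n : ℕ => 1 / (((n : ℝ) + 1) * π) ^ 2) :
    (∀ x, HasDerivAt (fun x => ∑' n : ℕ, c n * Real.sin (((n : ℝ) + 1) * π * x))
      (∑' n : ℕ, c n * (Real.cos (((n : ℝ) + 1) * π * x) * (((n : ℝ) + 1) * π))) x) ∧
    ∀ x, HasDerivAt
      (fun x => ∑' n : ℕ, c n * (Real.cos (((n : ℝ) + 1) * π * x) * (((n : ℝ) + 1) * π)))
      (∑' n : ℕ, c n * (-Real.sin (((n : ℝ) + 1) * π * x) * (((n : ℝ) + 1) * π) *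
        (((n : ℝ) + 1) * π))) x := by
  have hlin : ∀ (n : ℕ) (y : ℝ), HasDerivAt (fun y => ((n : ℝ) + 1) * π * y) (((n : ℝ) + 1) * π) y :=
    fun n y => by simpa using (hasDerivAt_id y).const_mul (((n : ℝ) + 1) * π)
  have hw : ∀ n : ℕ, 1 ≤ ((n : ℝ) + 1) * π := fun n => by
    nlinarith [Real.pi_gt_three, Nat.cast_nonneg (α := ℝ) n]
  have hK : ∀ n, |c n| * (((n : ℝ) + 1) * π) ^ 2 ≤ K * (1 / (((n : ℝ) + 1) * π) ^ 2) := by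
    intro n
    have h0 : 0 < ((n : ℝ) + 1) * π := by linarith [hw n]
    calc _ ≤ K / (((n : ℝ) + 1) * π) ^ 4 * (((n : ℝ) + 1) * π) ^ 2 := by gcongr; exact hc n
      _ = _ := by field_simp
  have hb1 : ∀ (n : ℕ) (y : ℝ), ‖c n * (Real.cos (((n : ℝ) + 1) * π * y) * (((n : ℝ) + 1) * π))‖
      ≤ K * (1 / (((n : ℝ) + 1) * π) ^ 2) := by
    intro n y
    have h0 : 0 < ((n : ℝ) + 1) * π := by linarith [hw n]
    refine le_trans ?_ (hK n)
    rw [norm_mul, norm_mul, Real.norm_eq_abs, Real.norm_eq_abs, Real.norm_eq_abs, abs_of_pos h0]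
    gcongr
    calc _ ≤ 1 * (((n : ℝ) + 1) * π) := by gcongr; exact Real.abs_cos_le_one _
      _ ≤ _ := by nlinarith [hw n]
  have hb2 : ∀ (n : ℕ) (y : ℝ), ‖c n * (-Real.sin (((n : ℝ) + 1) * π * y) * (((n : ℝ) + 1) * π) *
        (((n : ℝ) + 1) * π))‖ ≤ K * (1 / (((n : ℝ) + 1) * π) ^ 2) := by
    intro n y
    have h0 : 0 < ((n : ℝ) + 1) * π := by linarith [hw n]
    refine le_trans ?_ (hK n)
    rw [norm_mul, norm_mul, norm_mul, Real.norm_eq_abs, Real.norm_eq_abs, Real.norm_eq_abs,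
      abs_of_pos h0, abs_neg]
    gcongr
    calc _ ≤ 1 * (((n : ℝ) + 1) * π) * (((n : ℝ) + 1) * π) := by
          gcongr; exact Real.abs_sin_le_one _
      _ = _ := by ring
  constructor <;> intro x
  · refine hasDerivAt_tsum (hS.mul_left K) (fun n y => ((hlin n y).sin).const_mul _) hb1
      (y₀ := 0) (by simp) x
  · exact hasDerivAt_tsum (hS.mul_left K)
      (fun n y => (((hlin n y).cos).mul_const _).const_mul _) hb2
      (Summable.of_norm_bounded (hS.mul_left K) (fun n => hb1 n 0)) x

lemma heatKernel_zero_left (t y : ℝ) : heatKernel t 0 y = 0 := by simp [heatKernel]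

lemma heatKernel_one_left (t y : ℝ) : heatKernel t 1 y = 0 := by
  simp [heatKernel, sin_natCast_add_one_mul_pi]


/-- Duhamel's formula: let `T > 0` and `f : ℝ × ℝ → ℝ` be smooth with compact support contained
in `(0,T) × (0,1)`, and let `m(v,x) := ∫₀ᵛ ∫₀¹ g_{v−s}(x,y) f(s,y) dy ds`. Then for every
`v ∈ (0,T)` and `x ∈ (0,1)`, `m` is differentiable in `v` and twice differentiable in `x`, with
`∂/∂v m(v,x) = f(v,x) + (1/2) ∂²/∂x² m(v,x)`; moreover `m(v,0) = m(v,1) = 0` for all `v`. -/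
theorem duhamel_formula (T : ℝ) (hT : 0 < T) (f : ℝ × ℝ → ℝ)
    (hf : ContDiff ℝ (⊤ : ℕ∞) f) (hsupp : HasCompactSupport f)
    (hsub : tsupport f ⊆ Set.Ioo 0 T ×ˢ Set.Ioo (0:ℝ) 1) :
    (∀ v ∈ Set.Ioo 0 T, ∀ x ∈ Set.Ioo (0:ℝ) 1,
      Differentiable ℝ (fun x' => duhamel f v x') ∧
      Differentiable ℝ (deriv fun x' => duhamel f v x') ∧
      HasDerivAt (fun v' => duhamel f v' x)
        (f (v, x) + (1 / 2) * deriv (deriv fun x' => duhamel f v x') x) v) ∧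
    ∀ v : ℝ, duhamel f v 0 = 0 ∧ duhamel f v 1 = 0 := by
  have hf0 := hf.continuous
  have hsub' : tsupport f ⊆ {p | p.2 ∈ Set.Ioo (0 : ℝ) 1} := fun p hp => (hsub hp).2
  obtain ⟨C, hC⟩ := exists_abs_sineCoeff_le hf hsupp hsub'
  have hw : ∀ n : ℕ, 1 ≤ ((n : ℝ) + 1) * π := fun n => by
    nlinarith [Real.pi_gt_three, Nat.cast_nonneg (α := ℝ) n]
  have hC0 : 0 ≤ C := by
    have h1 := (abs_nonneg _).trans (hC 0 0)
    have h2 : 0 < (((0 : ℕ) : ℝ) + 1) * π := by linarith [hw 0]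
    have h3 := mul_nonneg h1 (pow_pos h2 4).le
    rwa [div_mul_cancel₀ _ (pow_pos h2 4).ne'] at h3
  have hS : Summable fun n : ℕ => 1 / (((n : ℝ) + 1) * π) ^ 2 := by
    have h := (summable_nat_add_iff 1).2 (Real.summable_one_div_nat_pow.2 one_lt_two)
    refine (h.mul_right (1 / π ^ 2)).congr fun n => ?_
    push_cast
    rw [mul_pow, one_div_mul_one_div]
  have hdom : ∀ n : ℕ, C / (((n : ℝ) + 1) * π) ^ 4 ≤ C * (1 / (((n : ℝ) + 1) * π) ^ 2) := by
    intro n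
    have h0 : 0 < ((n : ℝ) + 1) * π := by linarith [hw n]
    rw [mul_one_div]
    gcongr
    · exact hw n
    · norm_num
  have hB : ∀ (n : ℕ) s, |sineCoeff (fun y => f (s, y)) ((n : ℝ) + 1)|
      ≤ C * (1 / (((n : ℝ) + 1) * π) ^ 2) := fun n s => (hC n s).trans (hdom n)
  have hrep : ∀ v, 0 ≤ v → ∀ x, duhamel f v x = _ := fun v hv x =>
    duhamel_eq_tsum hf0 hsupp (hS.mul_left C) hB hv x
  refine ⟨fun v hv x hx => ?_, fun v => ?_⟩
  · have hcoef : ∀ w ∈ Set.Ioo 0 T, ∀ n : ℕ,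
        |duhamelCoeff f n w| ≤ C * T / (((n : ℝ) + 1) * π) ^ 4 := by
      intro w hw' n
      have h0 : 0 < ((n : ℝ) + 1) * π := by linarith [hw n]
      calc _ ≤ C / (((n : ℝ) + 1) * π) ^ 4 * w := abs_duhamelCoeff_le (hC n) hw'.1.le
        _ ≤ C / (((n : ℝ) + 1) * π) ^ 4 * T := by gcongr; exact hw'.2.le
        _ = _ := by ring
    obtain ⟨hd1, hd2⟩ := hasDerivAt_tsum_mul_sin (hcoef v hv) hS
    rw [show (fun x' => duhamel f v x') = _ from funext (hrep v hv.1.le)]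
    rw [show deriv _ = _ from funext fun y => (hd1 y).deriv]
    refine ⟨fun y => (hd1 y).differentiableAt, fun y => (hd2 y).differentiableAt, ?_⟩
    rw [(hd2 x).deriv]
    have hab : ∀ w ∈ Set.Ioo 0 T, ∀ n : ℕ, |dirichletEigenvalue n * duhamelCoeff f n w|
        ≤ C * T * (1 / (((n : ℝ) + 1) * π) ^ 2) := by
      intro w hw' n
      have h0 : 0 < ((n : ℝ) + 1) * π := by linarith [hw n]
      rw [abs_mul, abs_of_pos (dirichletEigenvalue_pos n)]
      calc _ ≤ (((n : ℝ) + 1) * π) ^ 2 * (C * T / (((n : ℝ) + 1) * π) ^ 4) := by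
            gcongr
            · unfold dirichletEigenvalue
              nlinarith [sq_nonneg (((n : ℝ) + 1) * π)]
            · exact hcoef w hw' n
        _ = _ := by field_simp
    have hbound : ∀ (n : ℕ), ∀ w ∈ Set.Ioo 0 T,
        ‖(sineCoeff (fun y => f (w, y)) ((n : ℝ) + 1)
          - dirichletEigenvalue n * duhamelCoeff f n w) * Real.sin (((n : ℝ) + 1) * π * x)‖
        ≤ C * (1 / (((n : ℝ) + 1) * π) ^ 2) + C * T * (1 / (((n : ℝ) + 1) * π) ^ 2) := by
      intro n w hw'
      rw [norm_mul]
      calc _ ≤ ‖sineCoeff (fun y => f (w, y)) ((n : ℝ) + 1)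
          - dirichletEigenvalue n * duhamelCoeff f n w‖ * 1 := by
            gcongr
            exact Real.abs_sin_le_one _
        _ ≤ _ := by
          rw [mul_one]
          exact (norm_sub_le _ _).trans (add_le_add (hB n w) (hab w hw' n))
    have hsum0 : Summable fun n : ℕ => duhamelCoeff f n v * Real.sin (((n : ℝ) + 1) * π * x) := by
      refine Summable.of_norm_bounded (hS.mul_left (C * T)) fun n => ?_
      have h0 : 0 < ((n : ℝ) + 1) * π := by linarith [hw n]
      rw [norm_mul]
      calc _ ≤ C * T / (((n : ℝ) + 1) * π) ^ 4 * 1 := by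
            gcongr
            · exact hcoef v hv n
            · exact Real.abs_sin_le_one _
        _ ≤ C * T / (((n : ℝ) + 1) * π) ^ 2 := by
            rw [mul_one]
            gcongr
            · exact hw n
            · norm_num
        _ = _ := by ring
    have hdv := hasDerivAt_tsum_of_isPreconnected
      ((hS.mul_left C).add (hS.mul_left (C * T))) isOpen_Ioo isPreconnected_Ioo
      (fun n w _ => (hasDerivAt_duhamelCoeff hf0 n w).mul_const
        (Real.sin (((n : ℝ) + 1) * π * x))) hbound hv hsum0 hv
    have hdv' := hdv.congr_of_eventuallyEq (f₁ := fun v' => duhamel f v' x) (by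
      filter_upwards [Ioi_mem_nhds hv.1] with w hw' using hrep w (le_of_lt hw') x)
    refine hdv'.congr_deriv ?_
    have hvan : ∀ y, y ∉ Set.Ioo (0 : ℝ) 1 → f (v, y) = 0 := fun y hy =>
      image_eq_zero_of_notMem_tsupport fun h => hy (hsub' h)
    have hfour := hasSum_sineCoeff_mul_sin (h := fun y => f (v, y)) (by fun_prop)
      (fun y hy => hvan y fun h => absurd h.1 (not_lt.2 hy))
      (fun y hy => hvan y fun h => absurd h.2 (not_lt.2 hy))
      (Summable.of_norm_bounded (hS.mul_left C) fun n => hB n v) hx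
    rw [← hfour.tsum_eq, ← tsum_mul_left, ← Summable.tsum_add hfour.summable]
    · congr 1
      funext n
      unfold dirichletEigenvalue
      ring
    · refine Summable.of_norm_bounded (hS.mul_left (C * T)) fun n => ?_
      rw [show 1 / 2 * (duhamelCoeff f n v * (-Real.sin (((n : ℝ) + 1) * π * x) *
        (((n : ℝ) + 1) * π) * (((n : ℝ) + 1) * π))) = -(dirichletEigenvalue n *
        duhamelCoeff f n v) * Real.sin (((n : ℝ) + 1) * π * x) by
          unfold dirichletEigenvalue; ring, norm_mul, norm_neg]
      calc _ ≤ ‖dirichletEigenvalue n * duhamelCoeff f n v‖ * 1 := by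
            gcongr
            exact Real.abs_sin_le_one _
        _ ≤ _ := by rw [mul_one]; exact hab v hv n
  · simp [duhamel, heatKernel_zero_left, heatKernel_one_left]
end
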